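/- For each integer i, let (ker L_i)^⊥ = {σ ∈ C_i(Δ) : σ·τ = 0 for all τ ∈ ker L_i}. Then im L_i ⊆ (ker L_i)^⊥ ⊆ ker ∂_i, and the subgroup (ker L_i)^⊥ / im L_i of the critical group crit_i(Δ) = ker ∂_i / im L_i is exactly the torsion subgroup T(crit_i(Δ)). In words: the group of i-chains of degree zero modulo the firing rules is the torsion part of the i-th critical group. -/

import Mathlib

open Finset Matrix

/-- A finite abstract simplicial complex on the vertex set `Fin n`: a collection of
finite subsets of `Fin n` (its faces) closed under taking subsets. -/
structure SComplex (n : ℕ) where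
  faces : Finset (Finset (Fin n))
  down_closed : ∀ s ∈ faces, ∀ t ⊆ s, t ∈ faces

namespace SComplex

variable {n : ℕ} (Δ : SComplex n)

/-- The faces of cardinality `k`, i.e. the `(k-1)`-dimensional faces. -/
def Faces (k : ℕ) : Finset (Finset (Fin n)) :=
  Δ.faces.filter fun f => f.card = k

/-- The group of `(k-1)`-dimensional chains: formal `ℤ`-linear combinations of the
faces of cardinality `k`.  (So `Chain 0` plays the role of `C_{-1}(Δ) ≅ ℤ`, generated
by the empty face, and `Chain (i+1)` is the group `C_i(Δ)` of `i`-dimensional chains.) -/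
abbrev Chain (k : ℕ) : Type := {f // f ∈ Δ.Faces k} → ℤ

/-- The sign `(-1)^j` with which the subface `g` (obtained from `f` by deleting its
`j`-th smallest vertex) occurs in the boundary of `f`; `0` if `g` is not a
codimension-one subface of `f`. -/
def bcoef (f g : Finset (Fin n)) : ℤ :=
  if g ⊆ f ∧ f.card = g.card + 1 then
    ∑ v ∈ f \ g, (-1 : ℤ) ^ (f.filter (fun x => x < v)).card
  else 0

/-- The matrix (in the standard bases, with the standard orientation) of the boundary
map from chains on faces of cardinality `k+1` to chains on faces of cardinality `k`. -/
def B (k : ℕ) : Matrix {f // f ∈ Δ.Faces k} {f // f ∈ Δ.Faces (k + 1)} ℤ :=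
  fun g f => bcoef (f : Finset (Fin n)) (g : Finset (Fin n))

/-- The simplicial boundary map `∂_k : C_k(Δ) → C_{k-1}(Δ)` (standard orientation),
as a map `Chain (k+1) → Chain k`.  For `k = 0` this is the reduced boundary map into
`C_{-1}(Δ) ≅ ℤ`. -/
noncomputable def bdry (k : ℕ) : Δ.Chain (k + 1) →ₗ[ℤ] Δ.Chain k :=
  (Δ.B k).mulVecLin

/-- The transpose `∂_kᵗ` of the boundary map. -/
noncomputable def tbdry (k : ℕ) : Δ.Chain k →ₗ[ℤ] Δ.Chain (k + 1) :=
  ((Δ.B k)ᵀ).mulVecLin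

/-- The matrix of the `i`-th (up-down combinatorial) Laplacian. -/
def LapM (i : ℕ) : Matrix {f // f ∈ Δ.Faces (i + 1)} {f // f ∈ Δ.Faces (i + 1)} ℤ :=
  Δ.B (i + 1) * (Δ.B (i + 1))ᵀ

/-- The `i`-th Laplacian `L_i = ∂_{i+1} ∘ ∂_{i+1}ᵗ` on `i`-dimensional chains. -/
noncomputable def Lap (i : ℕ) : Δ.Chain (i + 1) →ₗ[ℤ] Δ.Chain (i + 1) :=
  (Δ.LapM i).mulVecLin

/-- A chain is effective if all of its coefficients are nonnegative. -/
def Effective {k : ℕ} (σ : Δ.Chain k) : Prop := ∀ f, 0 ≤ σ f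

/-- `σ·h = Σ_f σ(f)h(f)`. -/
def dot {k : ℕ} (σ h : Δ.Chain k) : ℤ := ∑ f, σ f * h f

/-- The `i`-th nonnegative kernel `ker⁺L_i`: effective `i`-chains in `ker L_i`. -/
def kerPlus (i : ℕ) : Set (Δ.Chain (i + 1)) :=
  {τ | Δ.Lap i τ = 0 ∧ Δ.Effective τ}

/-- Two `i`-chains are linearly equivalent if their difference lies in `im L_i`. -/
def LinEquiv (i : ℕ) (σ σ' : Δ.Chain (i + 1)) : Prop :=
  σ' - σ ∈ LinearMap.range (Δ.Lap i)

/-- An `i`-chain is winnable if it is linearly equivalent to an effective `i`-chain. -/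
def Winnable (i : ℕ) (σ : Δ.Chain (i + 1)) : Prop :=
  ∃ σ', Δ.Effective σ' ∧ Δ.LinEquiv i σ σ'

/-- The Hilbert basis of `ker⁺L_i`: its nonzero elements that are not the sum of two
nonzero elements of `ker⁺L_i`. -/
def hilbBasis (i : ℕ) : Set (Δ.Chain (i + 1)) :=
  {τ | τ ∈ Δ.kerPlus i ∧ τ ≠ 0 ∧
    ¬ ∃ a ∈ Δ.kerPlus i, ∃ b ∈ Δ.kerPlus i, a ≠ 0 ∧ b ≠ 0 ∧ τ = a + b}

/-- The cycles among the chains on faces of cardinality `k`: the kernel of the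
(reduced) boundary map `∂_{k-1}`.  For `k = 0` (the `(-1)`-chains, where the boundary
map is zero) every chain is a cycle. -/
noncomputable def cycles : (k : ℕ) → Submodule ℤ (Δ.Chain k)
  | 0 => ⊤
  | (k + 1) => LinearMap.ker (Δ.bdry k)

/-- The image of the `i`-th Laplacian, viewed inside the `i`-cycles. -/
noncomputable def critSub (i : ℕ) : Submodule ℤ ↥(Δ.cycles (i + 1)) :=
  Submodule.comap (Δ.cycles (i + 1)).subtype (LinearMap.range (Δ.Lap i))

/-- The `i`-th critical group `crit_i(Δ) = ker ∂_i / im L_i`. -/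
noncomputable abbrev Crit (i : ℕ) : Type :=
  ↥(Δ.cycles (i + 1)) ⧸ Δ.critSub i

/-- The image of the boundary map `∂_k`, viewed inside the cycles `cycles k`. -/
noncomputable def bdrySub (k : ℕ) : Submodule ℤ ↥(Δ.cycles k) :=
  Submodule.comap (Δ.cycles k).subtype (LinearMap.range (Δ.bdry k))

/-- The reduced homology group `H̃_{k-1}(Δ) = ker ∂_{k-1} / im ∂_k` (so the `i`-th
reduced homology group of `Δ` is `RedHomologyAt (i+1)`). -/
noncomputable abbrev RedHomologyAt (k : ℕ) : Type :=
  ↥(Δ.cycles k) ⧸ Δ.bdrySub k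

/-- The orthogonal complement `(ker L_i)^⊥` of `ker L_i` in the `i`-chains. -/
def kerPerp (i : ℕ) : Submodule ℤ (Δ.Chain (i + 1)) where
  carrier := {σ | ∀ τ ∈ LinearMap.ker (Δ.Lap i), Δ.dot σ τ = 0}
  add_mem' := by
    intro a b ha hb τ hτ
    have h : Δ.dot (a + b) τ = Δ.dot a τ + Δ.dot b τ := by
      simp [dot, Pi.add_apply, add_mul, Finset.sum_add_distrib]
    rw [h, ha τ hτ, hb τ hτ, add_zero]
  zero_mem' := by
    intro τ hτ
    simp [dot]
  smul_mem' := by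
    intro c a ha τ hτ
    have h : Δ.dot (c • a) τ = c * Δ.dot a τ := by
      simp [dot, Pi.smul_apply, Finset.mul_sum, mul_assoc]
    rw [h, ha τ hτ, mul_zero]

/-! ### Pseudomanifolds -/

/-- `Δ` is a pseudomanifold of dimension `d` (the facets are the faces of
cardinality `d+1`): it is pure, non-branching, and strongly connected. -/
def IsPseudomanifold (d : ℕ) : Prop :=
  (∀ f ∈ Δ.faces, ∃ g ∈ Δ.Faces (d + 1), f ⊆ g) ∧
  (∀ g ∈ Δ.Faces d, ((Δ.Faces (d + 1)).filter fun f => g ⊆ f).card ≤ 2) ∧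
  (∀ f ∈ Δ.Faces (d + 1), ∀ f' ∈ Δ.Faces (d + 1),
    Relation.ReflTransGen
      (fun a b => a ∈ Δ.Faces (d + 1) ∧ b ∈ Δ.Faces (d + 1) ∧ (a ∩ b).card = d) f f')

/-- The boundary `∂Δ` of a `d`-dimensional pseudomanifold: the `(d-1)`-faces contained
in exactly one facet. -/
def pmBoundary (d : ℕ) : Finset (Finset (Fin n)) :=
  (Δ.Faces d).filter fun g => ((Δ.Faces (d + 1)).filter fun f => g ⊆ f).card = 1

/-- A pseudomanifold orientation for a `d`-dimensional pseudomanifold: a top chain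
`γ` with all coefficients `±1` whose boundary is supported on `∂Δ`. -/
noncomputable def IsOrientation (d : ℕ) (γ : Δ.Chain (d + 1)) : Prop :=
  (∀ f, γ f = 1 ∨ γ f = -1) ∧
  (∀ g : {f // f ∈ Δ.Faces d},
    (g : Finset (Fin n)) ∉ Δ.pmBoundary d → Δ.bdry d γ g = 0)

/-- `γ_j` as a top-dimensional chain, for a vertex `j` of the `γ`-incidence graph:
the extra vertex `γ_0 = 0` is encoded by `none`, and the oriented facet `γ_f` by
`some f`. -/
noncomputable def gammaInd (D : ℕ) (γ : Δ.Chain (D + 1)) :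
    Option {f // f ∈ Δ.Faces (D + 1)} → Δ.Chain (D + 1)
  | none => 0
  | some f => Pi.single f (γ f)

/-- The edge of the `γ`-incidence graph corresponding to the `(D-1)`-dimensional face
`σ` goes from the vertex `a` to the vertex `b`: this means `∂ᵗ(σ) = γ_b - γ_a`. -/
noncomputable def edgeFromTo (D : ℕ) (γ : Δ.Chain (D + 1)) (σ : {f // f ∈ Δ.Faces D})
    (a b : Option {f // f ∈ Δ.Faces (D + 1)}) : Prop :=
  Δ.tbdry D (Pi.single σ 1) = Δ.gammaInd D γ b - Δ.gammaInd D γ a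

/-- `τ` is the incidence vector of a simple directed cycle of the `γ`-incidence graph
`Γ(Δ,γ)`: there is a closed directed walk with pairwise distinct vertices and pairwise
distinct edges whose edge labels sum to `τ`. -/
noncomputable def IsCycleVector (D : ℕ) (γ : Δ.Chain (D + 1)) (τ : Δ.Chain D) : Prop :=
  ∃ (k : ℕ) (hk : 0 < k) (v : Fin k → Option {f // f ∈ Δ.Faces (D + 1)})
    (e : Fin k → {f // f ∈ Δ.Faces D}),
    Function.Injective v ∧ Function.Injective e ∧
    (∀ t : Fin k, Δ.edgeFromTo D γ (e t) (v t) (v ⟨(t.1 + 1) % k, Nat.mod_lt _ hk⟩)) ∧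
    τ = ∑ t : Fin k, Pi.single (e t) (1 : ℤ)

/-! ### Spanning forests -/

/-- The chains supported on a set `F` of faces. -/
def suppIn (k : ℕ) (F : Finset (Finset (Fin n))) : Submodule ℤ (Δ.Chain k) where
  carrier := {σ | ∀ f : {f // f ∈ Δ.Faces k}, (f : Finset (Fin n)) ∉ F → σ f = 0}
  add_mem' := by
    intro a b ha hb f hf
    simp [Pi.add_apply, ha f hf, hb f hf]
  zero_mem' := by intro f hf; rfl
  smul_mem' := by
    intro c a ha f hf
    simp [Pi.smul_apply, ha f hf]

/-- The reduced homology group `H̃_{i-1}(Υ)` of the subcomplex `Υ` with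
`Skel_{i-1}(Υ) = Skel_{i-1}(Δ)` and with set of `i`-faces `F`: namely
`ker ∂_{i-1} / ∂_i(chains supported on F)`. -/
noncomputable abbrev forestHom (i : ℕ) (F : Finset (Finset (Fin n))) : Type :=
  ↥(Δ.cycles i) ⧸ Submodule.comap (Δ.cycles i).subtype
      (Submodule.map (Δ.bdry i) (Δ.suppIn (i + 1) F))

/-- `F ⊆ Δ_i` encodes a spanning `i`-forest of `Δ`: the `i`-dimensional subcomplex
`Υ` with `Skel_{i-1}(Υ) = Skel_{i-1}(Δ)` and with `i`-faces `F`, subject to: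
`H̃_i(Υ) = 0`; `β̃_{i-1}(Υ) = β̃_{i-1}(Δ)`; and `|Υ_i| = |Δ_i| - β̃_i(Skel_i(Δ))`
(note `H̃_i(Skel_i(Δ)) = ker ∂_i` since `Skel_i(Δ)` has no `(i+1)`-faces). -/
noncomputable def IsSpanningForest (i : ℕ) (F : Finset (Finset (Fin n))) : Prop :=
  F ⊆ Δ.Faces (i + 1) ∧
  (∀ σ ∈ Δ.suppIn (i + 1) F, Δ.bdry i σ = 0 → σ = 0) ∧
  Module.finrank ℤ (Δ.forestHom i F) = Module.finrank ℤ (Δ.RedHomologyAt i) ∧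
  F.card = (Δ.Faces (i + 1)).card - Module.finrank ℤ ↥(Δ.cycles (i + 1))

open scoped Classical in
/-- The `i`-forest number `τ_i(Δ) = Σ_Υ |T(H̃_{i-1}(Υ))|²`, the sum over all spanning
`i`-forests of `Δ`. -/
noncomputable def forestNumber (i : ℕ) : ℕ :=
  ∑ F ∈ (Δ.Faces (i + 1)).powerset.filter (fun F => Δ.IsSpanningForest i F),
    (Nat.card ↥(Submodule.torsion ℤ (Δ.forestHom i F))) ^ 2

/-- Restriction of chains to the coordinates indexed by a subset `Θ` of the faces
(i.e. setting the remaining coordinates to `0`). -/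
noncomputable def restrictTo (k : ℕ) (Θ : Finset (Finset (Fin n)))
    (hΘ : Θ ⊆ Δ.Faces k) : Δ.Chain k →ₗ[ℤ] ({f // f ∈ Θ} → ℤ) where
  toFun σ := fun a => σ ⟨a.1, hΘ a.2⟩
  map_add' := by intros; rfl
  map_smul' := by intros; rfl

/-- The reduced Laplacian: the square submatrix of `L_i` consisting of the rows
and columns indexed by `Θ`, as a linear map `ℤΘ → ℤΘ`. -/
noncomputable def redLap (i : ℕ) (Θ : Finset (Finset (Fin n)))
    (hΘ : Θ ⊆ Δ.Faces (i + 1)) : ({f // f ∈ Θ} → ℤ) →ₗ[ℤ] ({f // f ∈ Θ} → ℤ) :=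
  (Matrix.of fun a b : {f // f ∈ Θ} =>
    Δ.LapM i ⟨a.1, hΘ a.2⟩ ⟨b.1, hΘ b.2⟩).mulVecLin

end SComplex

/-- An element of a finitely generated module over a principal ideal domain that is killed by
every linear functional is torsion. -/
lemma Submodule.mem_torsion_of_forall_dual_eq_zero {R M : Type*} [CommRing R] [IsDomain R]
    [IsPrincipalIdealRing R] [AddCommGroup M] [Module R M] [Module.Finite R M] {x : M}
    (h : ∀ φ : Module.Dual R M, φ x = 0) : x ∈ Submodule.torsion R M := by
  rw [← Submodule.Quotient.mk_eq_zero, ← Module.forall_dual_apply_eq_zero_iff R]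
  exact fun φ => h (φ ∘ₗ (Submodule.torsion R M).mkQ)

namespace SComplex

variable {n : ℕ}

lemma bcoef_erase {f : Finset (Fin n)} {v : Fin n} (hv : v ∈ f) :
    bcoef f (f.erase v) = (-1 : ℤ) ^ (f.filter (fun x => x < v)).card := by
  have hsd : f \ f.erase v = {v} := by
    ext x
    simp only [mem_sdiff, mem_erase, mem_singleton]
    grind
  rw [bcoef, if_pos ⟨erase_subset _ _, (card_erase_add_one hv).symm⟩, hsd, sum_singleton]

lemma exists_erase_of_bcoef_ne_zero {f g : Finset (Fin n)} (h : bcoef f g ≠ 0) :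
    ∃ v ∈ f, g = f.erase v := by
  have hfg : g ⊆ f ∧ f.card = g.card + 1 := by
    by_contra hc
    exact h (if_neg hc)
  obtain ⟨v, hv⟩ := card_eq_one.1 (show (f \ g).card = 1 by
    rw [card_sdiff_of_subset hfg.1]; omega)
  have hvf : v ∈ f ∧ v ∉ g := by
    rw [← mem_sdiff, hv]
    exact mem_singleton_self v
  refine ⟨v, hvf.1, eq_of_subset_of_card_le (subset_erase.2 ⟨hfg.1, hvf.2⟩) ?_⟩
  rw [card_erase_of_mem hvf.1]
  omega

lemma bcoef_erase_erase_add {f : Finset (Fin n)} {a b : Fin n} (ha : a ∈ f) (hb : b ∈ f)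
    (hab : a < b) :
    bcoef (f.erase a) ((f.erase a).erase b) * bcoef f (f.erase a) +
      bcoef (f.erase b) ((f.erase b).erase a) * bcoef f (f.erase b) = 0 := by
  rw [bcoef_erase ha, bcoef_erase hb, bcoef_erase (mem_erase.2 ⟨hab.ne', hb⟩),
    bcoef_erase (mem_erase.2 ⟨hab.ne, ha⟩), filter_erase, filter_erase,
    erase_eq_of_notMem (s := f.filter (fun x => x < a)) (by simp [hab.le]),
    ← card_erase_add_one (s := f.filter (fun x => x < b)) (a := a) (by simp [ha, hab])]
  ring

variable (Δ : SComplex n)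

lemma B_mul_B_succ (k : ℕ) : Δ.B k * Δ.B (k + 1) = 0 := by
  ext ⟨e, he⟩ ⟨f, hf⟩
  simp only [Faces, mem_filter] at he hf
  rw [Matrix.mul_apply]
  simp only [B, Matrix.zero_apply]
  rw [Finset.sum_coe_sort (Δ.Faces (k + 1)) (fun g => bcoef g e * bcoef f g)]
  by_contra hne
  obtain ⟨g, -, hg⟩ := exists_ne_zero_of_sum_ne_zero hne
  obtain ⟨u, hu, rfl⟩ := exists_erase_of_bcoef_ne_zero (right_ne_zero_of_mul hg)
  obtain ⟨w, hw, rfl⟩ := exists_erase_of_bcoef_ne_zero (left_ne_zero_of_mul hg)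
  obtain ⟨hwu, hwf⟩ := mem_erase.1 hw
  have hface : ∀ v ∈ f, f.erase v ∈ Δ.Faces (k + 1) := fun v hv =>
    mem_filter.2 ⟨Δ.down_closed f hf.1 _ (erase_subset _ _), by
      rw [card_erase_of_mem hv]; omega⟩
  have hne' : f.erase u ≠ f.erase w := fun h => by
    have := h ▸ hw
    exact notMem_erase w f this
  apply hne
  rw [← sum_subset (s₁ := {f.erase u, f.erase w}), sum_pair hne']
  · rcases hwu.lt_or_gt with h | h
    · have := bcoef_erase_erase_add hwf hu h
      rw [erase_right_comm (a := w)] at this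
      rwa [add_comm]
    · have := bcoef_erase_erase_add hu hwf h
      rwa [erase_right_comm (a := w)] at this
  · intro x hx
    rcases mem_insert.1 hx with rfl | hx
    · exact hface u hu
    · exact mem_singleton.1 hx ▸ hface w hwf
  · intro x _ hx
    by_contra hc
    obtain ⟨v, hv, rfl⟩ := exists_erase_of_bcoef_ne_zero (right_ne_zero_of_mul hc)
    obtain ⟨t, ht, hte⟩ := exists_erase_of_bcoef_ne_zero (left_ne_zero_of_mul hc)
    have hvn : v ∉ (f.erase u).erase w := by
      rw [hte]
      simp
    apply hx
    have : v = u ∨ v = w := by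
      simp only [mem_erase] at hvn
      tauto
    rcases this with rfl | rfl <;> simp

lemma dot_eq_dotProduct {k : ℕ} (σ τ : Δ.Chain k) : Δ.dot σ τ = σ ⬝ᵥ τ := rfl

lemma dot_Lap (i : ℕ) (σ τ : Δ.Chain (i + 1)) :
    Δ.dot (Δ.Lap i σ) τ = Δ.dot σ (Δ.Lap i τ) := by
  have hsymm : (Δ.LapM i)ᵀ = Δ.LapM i := by simp [LapM]
  simp only [dot_eq_dotProduct, Lap, Matrix.mulVecLin_apply]
  rw [Matrix.dotProduct_mulVec, ← Matrix.mulVec_transpose, hsymm]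

lemma range_Lap_le_kerPerp (i : ℕ) : LinearMap.range (Δ.Lap i) ≤ Δ.kerPerp i := by
  rintro _ ⟨x, rfl⟩ τ hτ
  rw [dot_Lap, LinearMap.mem_ker.1 hτ, dot_eq_dotProduct, dotProduct_zero]

lemma kerPerp_le_cycles (i : ℕ) : Δ.kerPerp i ≤ Δ.cycles (i + 1) := by
  intro σ hσ
  refine LinearMap.mem_ker.2 (funext fun g => ?_)
  have h := hσ ((Δ.B i)ᵀ *ᵥ Pi.single g 1) (LinearMap.mem_ker.2 ?_)
  · rw [dot_eq_dotProduct, Matrix.dotProduct_mulVec, Matrix.vecMul_transpose,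
      dotProduct_single, mul_one] at h
    exact h
  · rw [Lap, Matrix.mulVecLin_apply, LapM, Matrix.mulVec_mulVec, Matrix.mul_assoc,
      ← Matrix.transpose_mul, B_mul_B_succ, Matrix.transpose_zero, Matrix.mul_zero,
      Matrix.zero_mulVec]

lemma mem_ker_Lap_of_forall_dot_eq_zero {i : ℕ} {τ : Δ.Chain (i + 1)}
    (h : ∀ x, Δ.dot (Δ.Lap i x) τ = 0) : τ ∈ LinearMap.ker (Δ.Lap i) := by
  refine LinearMap.mem_ker.2 (dotProduct_eq_zero _ fun x => ?_)
  rw [dotProduct_comm, ← dot_eq_dotProduct, ← dot_Lap, h]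

lemma exists_smul_mem_range_Lap {i : ℕ}
    {σ : Δ.Chain (i + 1)} (hσ : σ ∈ Δ.kerPerp i) :
    ∃ m ∈ nonZeroDivisors ℤ, m • σ ∈ LinearMap.range (Δ.Lap i) := by
  have htor : (LinearMap.range (Δ.Lap i)).mkQ σ ∈ Submodule.torsion ℤ _ := by
    refine Submodule.mem_torsion_of_forall_dual_eq_zero fun φ => ?_
    let ψ : Module.Dual ℤ (Δ.Chain (i + 1)) := φ ∘ₗ (LinearMap.range (Δ.Lap i)).mkQ
    let τ : Δ.Chain (i + 1) := fun f => ψ (Pi.single f 1)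
    have hψ : ∀ x, ψ x = Δ.dot x τ := fun x => by
      conv_lhs => rw [pi_eq_sum_univ' x, map_sum]
      refine Finset.sum_congr rfl fun f _ => ?_
      rw [map_smul, smul_eq_mul]
    refine (hψ σ).trans (hσ τ (Δ.mem_ker_Lap_of_forall_dot_eq_zero fun x => ?_))
    rw [← hψ]
    have : (LinearMap.range (Δ.Lap i)).mkQ (Δ.Lap i x) = 0 := by simp
    exact (congrArg φ this).trans (map_zero φ)
  obtain ⟨⟨m, hm⟩, hmσ⟩ := htor
  refine ⟨m, hm, ?_⟩
  rw [← Submodule.Quotient.mk_eq_zero]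
  exact hmσ

lemma mem_kerPerp_of_smul_mem {i : ℕ} {m : ℤ} (hm : m ≠ 0)
    {σ : Δ.Chain (i + 1)} (h : m • σ ∈ Δ.kerPerp i) : σ ∈ Δ.kerPerp i := by
  intro τ hτ
  have := h τ hτ
  rw [dot_eq_dotProduct, smul_dotProduct, smul_eq_mul] at this
  exact (mul_eq_zero.1 this).resolve_left hm

end SComplex

/-- `im L_i ⊆ (ker L_i)^⊥ ⊆ ker ∂_i`, and the subgroup
`(ker L_i)^⊥ / im L_i` of the critical group `crit_i(Δ) = ker ∂_i / im L_i` is exactly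
its torsion subgroup: the group of `i`-chains of degree zero modulo firing rules is
the torsion part of the `i`-th critical group. -/
theorem degree_zero_chains_eq_torsion {n : ℕ} (Δ : SComplex n) (i : ℕ) :
    LinearMap.range (Δ.Lap i) ≤ Δ.kerPerp i ∧
    Δ.kerPerp i ≤ Δ.cycles (i + 1) ∧
    Submodule.map (Δ.critSub i).mkQ
        (Submodule.comap (Δ.cycles (i + 1)).subtype (Δ.kerPerp i)) =
      Submodule.torsion ℤ (Δ.Crit i) := by
  refine ⟨Δ.range_Lap_le_kerPerp i, Δ.kerPerp_le_cycles i, le_antisymm ?_ ?_⟩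
  · rintro _ ⟨σ, hσ, rfl⟩
    obtain ⟨m, hm, h⟩ := Δ.exists_smul_mem_range_Lap hσ
    exact ⟨⟨m, hm⟩, (Submodule.Quotient.mk_eq_zero (Δ.critSub i)).2 h⟩
  · intro x hx
    obtain ⟨σ, rfl⟩ := (Δ.critSub i).mkQ_surjective x
    obtain ⟨⟨m, hm⟩, h⟩ := hx
    have hmem : m • σ ∈ Δ.critSub i := (Submodule.Quotient.mk_eq_zero (Δ.critSub i)).1 h
    exact ⟨σ, Δ.mem_kerPerp_of_smul_mem (nonZeroDivisors.ne_zero hm)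
      (Δ.range_Lap_le_kerPerp i hmem), rfl⟩
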